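/- arXiv:1711.04631 — 2 statements merged into one kernel-verified Lean document; each statement's English description precedes it below -/
import Mathlib

section
/- Let K ⊂ H⁺(y₀)×X be an invariant set and let (N₁,N₂) and (M₁,M₂) be index pairs for (y₀,K). Then the pointed homotopy types of (N₁/N₂,[N₂]) and (M₁/M₂,[M₂]) agree, i.e. there exists a pointed homotopy equivalence (N₁/N₂,[N₂]) → (M₁/M₂,[M₂]). -/
open Filter Topology Set
open scoped NNReal ENNReal

noncomputable section

/-- A partial semiflow on a topological space `Z`. The value `none` plays the role of the
symbol `◊` ("undefined").  Time is modelled by `ℝ≥0`. -/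
structure PartialSemiflow (Z : Type*) [TopologicalSpace Z] where
  /-- The (partially defined) flow map. -/
  flow : ℝ≥0 → Z → Option Z
  /-- The domain of definition is open in `[0,∞) × Z`. -/
  isOpen_dom : IsOpen {p : ℝ≥0 × Z | (flow p.1 p.2).isSome = true}
  /-- The flow is continuous on its domain of definition. -/
  continuous_flow : ∀ V : Set Z, IsOpen V →
    IsOpen {p : ℝ≥0 × Z | ∃ z ∈ V, flow p.1 p.2 = some z}
  /-- `z π 0 = z`. -/
  flow_zero : ∀ z, flow 0 z = some z
  /-- The semigroup property; `◊ π t = ◊` is built into `Option.bind`. -/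
  flow_add : ∀ (t₁ t₂ : ℝ≥0) (z : Z), flow (t₁ + t₂) z = (flow t₁ z).bind (flow t₂)

namespace PartialSemiflow

variable {Z : Type*} [TopologicalSpace Z] (π : PartialSemiflow Z)

/-- `π.mem t z M` means: `z π t` is defined and belongs to `M`. -/
def mem (t : ℝ≥0) (z : Z) (M : Set Z) : Prop := ∃ w ∈ M, π.flow t z = some w

/-- `π.segMem t z M` means `z π [0,t] ⊆ M`. -/
def segMem (t : ℝ≥0) (z : Z) (M : Set Z) : Prop := ∀ s ≤ t, π.mem s z M

/-- A full solution `u : ℝ → Z` of the semiflow. -/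
def IsSolution (u : ℝ → Z) : Prop :=
  ∀ (t₀ : ℝ) (s : ℝ≥0), π.flow s (u t₀) = some (u (t₀ + (s : ℝ)))

/-- The largest invariant subset of `N`. -/
def Inv (N : Set Z) : Set Z :=
  {z | ∃ u : ℝ → Z, π.IsSolution u ∧ (∀ t, u t ∈ N) ∧ u 0 = z}

/-- The largest negatively invariant subset of `N` (solutions on `(-∞,0]`). -/
def InvMinus (N : Set Z) : Set Z :=
  {z | ∃ u : ℝ → Z, (∀ t ≤ (0 : ℝ), u t ∈ N) ∧
    (∀ (t₀ : ℝ) (s : ℝ≥0), t₀ + (s : ℝ) ≤ 0 → π.flow s (u t₀) = some (u (t₀ + (s : ℝ)))) ∧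
    u 0 = z}

/-- Strong admissibility of a set `M`: asymptotic compactness together with
non-explosion of the semiflow in `M`. -/
def StronglyAdmissible (M : Set Z) : Prop :=
  (∀ (z : ℕ → Z) (t : ℕ → ℝ≥0),
      (∀ n, π.segMem (t n) (z n) M) →
      ∃ w : ℕ → Z, (∀ n, π.flow (t n) (z n) = some (w n)) ∧
        ∃ φ : ℕ → ℕ, StrictMono φ ∧ ∃ l : Z, Tendsto (w ∘ φ) atTop (nhds l)) ∧
  (∀ (z : Z) (t : ℝ≥0), (∀ s < t, ∃ w ∈ M, π.flow s z = some w) → (π.flow t z).isSome)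

end PartialSemiflow

/-- A global (everywhere defined) semiflow on `Y`, the "translation" `y ↦ y^t`. -/
structure GlobalSemiflow (Y : Type*) [TopologicalSpace Y] where
  /-- The translation map. -/
  trans : ℝ≥0 → Y → Y
  continuous_trans : Continuous fun p : ℝ≥0 × Y => trans p.1 p.2
  trans_zero : ∀ y, trans 0 y = y
  trans_add : ∀ (s t : ℝ≥0) (y : Y), trans (s + t) y = trans t (trans s y)

variable {X Y : Type*} [MetricSpace X] [MetricSpace Y]

/-- `π` is a skew-product semiflow over the translation semiflow `σ`:  whenever
`(y,x) π t` is defined, its first component is `y^t`. -/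
def GlobalSemiflow.IsSkewProduct (σ : GlobalSemiflow Y) (π : PartialSemiflow (Y × X)) : Prop :=
  ∀ (t : ℝ≥0) (y : Y) (x : X) (w : Y × X), π.flow t (y, x) = some w → w.1 = σ.trans t y

/-- The positive hull `H⁺(y₀)` of `y₀`. -/
def hullPlus (σ : GlobalSemiflow Y) (y₀ : Y) : Set Y :=
  closure {y | ∃ t : ℝ≥0, σ.trans t y₀ = y}

/-- The space `H⁺(y₀) × X`, as a subset of `Y × X`. -/
def extSpace (σ : GlobalSemiflow Y) (y₀ : Y) : Set (Y × X) :=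
  (hullPlus σ y₀) ×ˢ (Set.univ : Set X)

/-- The map `r = r_{y₀} : [0,∞) × X → H⁺(y₀) × X`, `r(t,x) = (y₀^t, x)`. -/
def rMap (σ : GlobalSemiflow Y) (y₀ : Y) : ℝ≥0 × X → Y × X :=
  fun p => (σ.trans p.1 y₀, p.2)

/-- The canonical semiflow `χ = χ_{y₀}` on `[0,∞) × X`:
`(t,x) χ s = (t+s, Φ(s, y₀^t, x))`. -/
def chi (σ : GlobalSemiflow Y) (π : PartialSemiflow (Y × X)) (y₀ : Y)
    (s : ℝ≥0) (p : ℝ≥0 × X) : Option (ℝ≥0 × X) :=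
  (π.flow s (σ.trans p.1 y₀, p.2)).map fun w => (p.1 + s, w.2)

/-- `chiMem σ π y₀ s p M` means: `p χ s` is defined and belongs to `M`. -/
def chiMem (σ : GlobalSemiflow Y) (π : PartialSemiflow (Y × X)) (y₀ : Y)
    (s : ℝ≥0) (p : ℝ≥0 × X) (M : Set (ℝ≥0 × X)) : Prop :=
  ∃ q ∈ M, chi σ π y₀ s p = some q

/-- `N` is an isolating neighborhood for `K` in `H⁺(y₀) × X`. -/
def IsIsolatingNbhd (σ : GlobalSemiflow Y) (π : PartialSemiflow (Y × X)) (y₀ : Y)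
    (K N : Set (Y × X)) : Prop :=
  N ⊆ extSpace σ y₀ ∧ IsClosed N ∧
  (∀ z ∈ π.Inv N, N ∈ nhdsWithin z (extSpace σ y₀)) ∧ K = π.Inv N

/-- `W` is a neighborhood of `K` in `H⁺(y₀) × X`. -/
def IsNbhdOfIn (σ : GlobalSemiflow Y) (y₀ : Y) (K W : Set (Y × X)) : Prop :=
  W ⊆ extSpace σ y₀ ∧ ∀ z ∈ K, W ∈ nhdsWithin z (extSpace (X := X) σ y₀)

/-- A basic index pair in `[0,∞) × X` relative to the semiflow `χ_{y₀}`. -/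
structure IsBasicIndexPair (σ : GlobalSemiflow Y) (π : PartialSemiflow (Y × X)) (y₀ : Y)
    (N₁ N₂ : Set (ℝ≥0 × X)) : Prop where
  subset : N₂ ⊆ N₁
  closed₁ : IsClosed N₁
  closed₂ : IsClosed N₂
  ip2 : ∀ p ∈ N₁, ∀ t : ℝ≥0, ¬ chiMem σ π y₀ t p N₁ → ∃ s ≤ t, chiMem σ π y₀ s p N₂
  ip3 : ∀ p ∈ N₂, ∀ t : ℝ≥0, ¬ chiMem σ π y₀ t p N₂ → ∃ s ≤ t, ¬ chiMem σ π y₀ s p N₁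

/-- An index pair for `(y₀, K)`. -/
structure IsIndexPair (σ : GlobalSemiflow Y) (π : PartialSemiflow (Y × X)) (y₀ : Y)
    (K : Set (Y × X)) (N₁ N₂ : Set (ℝ≥0 × X)) : Prop where
  toBasic : IsBasicIndexPair σ π y₀ N₁ N₂
  ip4 : ∃ N : Set (Y × X), IsIsolatingNbhd σ π y₀ K N ∧ π.StronglyAdmissible N ∧
    N₁ \ N₂ ⊆ rMap σ y₀ ⁻¹' N
  ip5 : ∃ W : Set (Y × X), IsNbhdOfIn σ y₀ K W ∧ rMap σ y₀ ⁻¹' W ⊆ N₁ \ N₂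

/-- `N₂^{-T}(N₁) = {p ∈ N₁ : p χ s ∈ N₂ for some s ∈ [0,T]}`. -/
def backSet (σ : GlobalSemiflow Y) (π : PartialSemiflow (Y × X)) (y₀ : Y)
    (N₁ N₂ : Set (ℝ≥0 × X)) (T : ℝ≥0) : Set (ℝ≥0 × X) :=
  {p ∈ N₁ | ∃ s ≤ T, chiMem σ π y₀ s p N₂}


/-- The relation identifying all points of `A ∩ B`, together with an extra point
(which serves as the class `[B]` even when `A ∩ B = ∅`). -/
def quotRel {Z : Type*} (A B : Set Z) : ↥A ⊕ Unit → ↥A ⊕ Unit → Prop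
  | Sum.inl a, Sum.inl b => a = b ∨ ((a : Z) ∈ B ∧ (b : Z) ∈ B)
  | Sum.inl a, Sum.inr _ => (a : Z) ∈ B
  | Sum.inr _, Sum.inl b => (b : Z) ∈ B
  | Sum.inr _, Sum.inr _ => True

/-- The pointed quotient space `A/B`. -/
def PtdQuot {Z : Type*} [TopologicalSpace Z] (A B : Set Z) : Type _ := Quot (quotRel A B)

instance {Z : Type*} [TopologicalSpace Z] (A B : Set Z) : TopologicalSpace (PtdQuot A B) :=
  inferInstanceAs (TopologicalSpace (Quot _))

/-- The base point `[B]` of `A/B`. -/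
def PtdQuot.pt {Z : Type*} [TopologicalSpace Z] (A B : Set Z) : PtdQuot A B :=
  Quot.mk _ (Sum.inr ())

/-- `f : (Z, z₀) → (W, w₀)` is a pointed homotopy equivalence. -/
def IsPointedHomotopyEquiv {Z W : Type*} [TopologicalSpace Z] [TopologicalSpace W]
    (z₀ : Z) (w₀ : W) (f : C(Z, W)) : Prop :=
  f z₀ = w₀ ∧ ∃ g : C(W, Z), g w₀ = z₀ ∧
    Nonempty (ContinuousMap.HomotopyRel (g.comp f) (ContinuousMap.id Z) {z₀}) ∧
    Nonempty (ContinuousMap.HomotopyRel (f.comp g) (ContinuousMap.id W) {w₀})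

/-- There is a pointed homotopy equivalence `(Z,z₀) → (W,w₀)`. -/
def PointedHomotopyEquivalent {Z W : Type*} [TopologicalSpace Z] [TopologicalSpace W]
    (z₀ : Z) (w₀ : W) : Prop :=
  ∃ f : C(Z, W), IsPointedHomotopyEquiv z₀ w₀ f

variable {X Y : Type*} [MetricSpace X] [MetricSpace Y]

/-- `g⁺(z) = sup{t ≥ 0 : z π [0,t] ⊆ U}`, with `sup ∅ = 0`, valued in `[0,∞]`. -/
def gPlus (π : PartialSemiflow (Y × X)) (U : Set (Y × X)) (z : Y × X) : ℝ≥0∞ :=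
  ⨆ t ∈ {t : ℝ≥0 | π.segMem t z U}, (t : ℝ≥0∞)

/-- `g⁻(z) = sup{d(z π t, Inv⁻(N)) : t ∈ [0, g⁺(z)], z π t ≠ ◊}`, with `sup ∅ = 0`
and `d(·,∅) = ∞`, valued in `[0,∞]`. -/
def gMinus (π : PartialSemiflow (Y × X)) (U N : Set (Y × X)) (z : Y × X) : ℝ≥0∞ :=
  ⨆ t ∈ {t : ℝ≥0 | (t : ℝ≥0∞) ≤ gPlus π U z},
    ⨆ w ∈ {w : Y × X | π.flow t z = some w}, EMetric.infEdist w (π.InvMinus N)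

/-- The function `f(p) = sup{t₀ ≥ 0 : p χ s ∈ cl(N₁ \ N₂) for all s ∈ [0,t₀]}`,
with `sup ∅ = 0`, valued in `[0,∞]`. -/
def fTime (σ : GlobalSemiflow Y) (π : PartialSemiflow (Y × X)) (y₀ : Y)
    (N₁ N₂ : Set (ℝ≥0 × X)) (p : ℝ≥0 × X) : ℝ≥0∞ :=
  ⨆ t₀ ∈ {t₀ : ℝ≥0 | ∀ s ≤ t₀, chiMem σ π y₀ s p (closure (N₁ \ N₂))}, (t₀ : ℝ≥0∞)

/-- The α-limit set of a full solution `u`. -/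
def solAlphaLimit (u : ℝ → Y × X) : Set (Y × X) := ⋂ t : ℝ, closure (u '' Set.Iic t)

/-- The ω-limit set of a full solution `u`. -/
def solOmegaLimit (u : ℝ → Y × X) : Set (Y × X) := ⋂ t : ℝ, closure (u '' Set.Ici t)

/-- `(A, R)` is an attractor-repeller decomposition of the isolated invariant set `K`. -/
structure IsARDecomp (σ : GlobalSemiflow Y) (π : PartialSemiflow (Y × X)) (y₀ : Y)
    (K A R : Set (Y × X)) : Prop where
  A_subset : A ⊆ K
  R_subset : R ⊆ K
  disjoint : Disjoint A R
  A_isolated : ∃ N, IsIsolatingNbhd σ π y₀ A N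
  R_isolated : ∃ N, IsIsolatingNbhd σ π y₀ R N
  alternatives : ∀ u : ℝ → Y × X, π.IsSolution u → (∀ t, u t ∈ K) →
    (∀ t, u t ∈ A) ∨ (∀ t, u t ∈ R) ∨ (solAlphaLimit u ⊆ R ∧ solOmegaLimit u ⊆ A)

/-- An index triple for `(y₀, K, A, R)`. -/
structure IsIndexTriple (σ : GlobalSemiflow Y) (π : PartialSemiflow (Y × X)) (y₀ : Y)
    (K A R : Set (Y × X)) (N₁ N₂ N₃ : Set (ℝ≥0 × X)) : Prop where
  sub32 : N₃ ⊆ N₂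
  sub21 : N₂ ⊆ N₁
  pairK : IsIndexPair σ π y₀ K N₁ N₃
  pairA : IsIndexPair σ π y₀ A N₂ N₃

/-- An FM-index pair for `K` relative to `π`, restricted to `H⁺(y₀) × X`. -/
structure IsFMIndexPair (σ : GlobalSemiflow Y) (π : PartialSemiflow (Y × X)) (y₀ : Y)
    (K N₁ N₂ : Set (Y × X)) : Prop where
  subset : N₂ ⊆ N₁
  sub_ext : N₁ ⊆ extSpace σ y₀
  closed₁ : IsClosed N₁
  closed₂ : IsClosed N₂
  isolating : IsIsolatingNbhd σ π y₀ K (closure (N₁ \ N₂))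
  interior_K : ∀ z ∈ K, N₁ \ N₂ ∈ nhdsWithin z (extSpace σ y₀)
  posInv : ∀ z ∈ N₂, ∀ t : ℝ≥0, (∀ s ≤ t, π.mem s z N₁) → ∀ s ≤ t, π.mem s z N₂
  exit : ∀ z ∈ N₁, ∀ t : ℝ≥0, ¬ π.mem t z N₁ →
    ∃ s ≤ t, (∀ s' ≤ s, π.mem s' z N₁) ∧ π.mem s z N₂

namespace PartialSemiflow

section Basic

variable {Z : Type*} [TopologicalSpace Z] {χ : PartialSemiflow Z}

theorem mem.mono {t : ℝ≥0} {p : Z} {A B : Set Z} (h : χ.mem t p A) (hAB : A ⊆ B) :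
    χ.mem t p B :=
  let ⟨w, hw, hf⟩ := h
  ⟨w, hAB hw, hf⟩

theorem mem.diff {t : ℝ≥0} {p : Z} {A B : Set Z} (hA : χ.mem t p A) (hB : ¬ χ.mem t p B) :
    χ.mem t p (A \ B) :=
  let ⟨w, hw, hf⟩ := hA
  ⟨w, ⟨hw, fun hwB => hB ⟨w, hwB, hf⟩⟩, hf⟩

theorem mem_iff_of_flow_eq {t : ℝ≥0} {p q : Z} {A : Set Z} (h : χ.flow t p = some q) :
    χ.mem t p A ↔ q ∈ A := by
  simp [mem, h]

@[simp]
theorem mem_zero_iff {p : Z} {A : Set Z} : χ.mem 0 p A ↔ p ∈ A :=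
  mem_iff_of_flow_eq (χ.flow_zero p)

theorem flow_add_of_flow_eq {s t : ℝ≥0} {p q : Z} (h : χ.flow s p = some q) :
    χ.flow (s + t) p = χ.flow t q := by
  rw [χ.flow_add, h]; rfl

theorem mem_add_iff_of_flow_eq {s t : ℝ≥0} {p q : Z} {A : Set Z} (h : χ.flow s p = some q) :
    χ.mem (s + t) p A ↔ χ.mem t q A := by
  simp only [mem, flow_add_of_flow_eq h]

theorem isOpen_setOf_mem {U : Set Z} (hU : IsOpen U) :
    IsOpen {x : ℝ≥0 × Z | χ.mem x.1 x.2 U} :=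
  χ.continuous_flow U hU

/-- `χ` does not explode in `D`. -/
def NonExploding (χ : PartialSemiflow Z) (D : Set Z) : Prop :=
  ∀ (z : Z) (t : ℝ≥0), (∀ s < t, ∃ w ∈ D, χ.flow s z = some w) → (χ.flow t z).isSome

theorem NonExploding.isSome_flow {D : Set Z} (hD : χ.NonExploding D) {p : Z} {t : ℝ≥0}
    (h : ∀ s ≤ t, ∀ q, χ.flow s p = some q → q ∈ D) : (χ.flow t p).isSome := by
  by_contra hnone
  have hopen : IsOpen {s : ℝ≥0 | (χ.flow s p).isSome = true} :=
    χ.isOpen_dom.preimage (f := fun s : ℝ≥0 => (s, p)) (by fun_prop)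
  set S : Set ℝ≥0 := {s : ℝ≥0 | (χ.flow s p).isSome = true}ᶜ
  have htS : t ∈ S := hnone
  have hbdd : BddBelow S := OrderBot.bddBelow S
  have hinf : sInf S ∈ S := hopen.isClosed_compl.csInf_mem ⟨t, htS⟩ hbdd
  refine hinf (hD p _ fun s hs => ?_)
  have hsS : s ∉ S := notMem_of_lt_csInf hs hbdd
  obtain ⟨q, hq⟩ := Option.isSome_iff_exists.mp (not_not.mp hsS)
  exact ⟨q, h s (hs.le.trans (csInf_le hbdd htS)) q hq, hq⟩

end Basic

section Admissible

variable {Z : Type*} [MetricSpace Z] {π : PartialSemiflow Z} {N : Set Z}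

theorem StronglyAdmissible.isCompact_closure (hN : π.StronglyAdmissible N) :
    IsCompact (closure {w | ∃ z t, π.segMem t z N ∧ π.flow t z = some w}) := by
  refine IsSeqCompact.isCompact fun x hx => ?_
  have hx' : ∀ n : ℕ, ∃ c ∈ {w | ∃ z t, π.segMem t z N ∧ π.flow t z = some w},
      dist (x n) c < 1 / ((n : ℝ) + 1) := fun n =>
    Metric.mem_closure_iff.mp (hx n) _ Nat.one_div_pos_of_nat
  choose c hc hdist using hx'
  choose z t hseg hflow using hc
  obtain ⟨w, hw, φ, hφ, l, hl⟩ := hN.1 z t hseg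
  obtain rfl : w = c := funext fun n => Option.some_injective _ ((hw n).symm.trans (hflow n))
  have hlim : Tendsto (x ∘ φ) atTop (𝓝 l) := by
    refine (tendsto_iff_of_dist (f₁ := w ∘ φ) ?_).mp hl
    refine squeeze_zero (fun n => dist_nonneg) (fun n => ?_)
      ((tendsto_one_div_add_atTop_nhds_zero_nat (𝕜 := ℝ)).comp hφ.tendsto_atTop)
    rw [dist_comm]
    exact (hdist (φ n)).le
  exact ⟨l, isClosed_closure.mem_of_tendsto hlim (Eventually.of_forall fun n => hx _),
    φ, hφ, hlim⟩

/-- Points in the middle of long orbit segments inside a strongly admissible set `N`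
are close to the largest invariant subset of `N`. -/
theorem StronglyAdmissible.eventually_mem_of_segMem (hN : π.StronglyAdmissible N)
    (hNc : IsClosed N) {E W : Set Z} (hNE : N ⊆ E) (hW : ∀ z ∈ π.Inv N, W ∈ 𝓝[E] z) :
    ∀ᶠ n : ℕ in atTop, ∀ z, π.segMem (2 * n) z N → π.mem n z W := by
  by_contra hcon
  have hfreq : ∃ᶠ n : ℕ in atTop, ∃ z, π.segMem (2 * n) z N ∧ ¬ π.mem n z W := by
    simpa [Filter.Frequently] using hcon
  have hneBot : (atTop ⊓ 𝓟 {n : ℕ | ∃ z, π.segMem (2 * n) z N ∧ ¬ π.mem n z W}).NeBot :=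
    frequently_mem_iff_neBot.mp hfreq
  obtain ⟨U, hU⟩ := Ultrafilter.exists_le
    (atTop ⊓ 𝓟 {n : ℕ | ∃ z, π.segMem (2 * n) z N ∧ ¬ π.mem n z W})
  have hUP := le_principal_iff.mp (hU.trans inf_le_right)
  replace hU := hU.trans inf_le_left
  have hz : ∃ z : ℕ → Z, ∀ᶠ n : ℕ in (U : Filter ℕ),
      π.segMem (2 * n) (z n) N ∧ ¬ π.mem n (z n) W :=
    Filter.Eventually.choice hUP
  obtain ⟨z, hz⟩ := hz
  set v : ℕ → ℝ → Z := fun n s => (π.flow (Real.toNNReal (n + s)) (z n)).getD (z n) with hv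
  have hlarge : ∀ c : ℝ, ∀ᶠ n : ℕ in (U : Filter ℕ), c ≤ n := fun c =>
    hU ((eventually_ge_atTop ⌈c⌉₊).mono fun n hn => (Nat.le_ceil c).trans (by exact_mod_cast hn))
  have hle : ∀ (n : ℕ) (s : ℝ), |s| ≤ n → Real.toNNReal (n + s) ≤ 2 * n := by
    intro n s hs
    rw [Real.toNNReal_le_iff_le_coe]
    push_cast
    linarith [le_abs_self s]
  have hflow : ∀ s : ℝ, ∀ᶠ n : ℕ in (U : Filter ℕ), v n s ∈ N ∧
      π.flow (Real.toNNReal (n + s)) (z n) = some (v n s) ∧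
      π.segMem (Real.toNNReal (n + s)) (z n) N := by
    intro s
    filter_upwards [hz, hlarge |s|] with n hn hsn
    obtain ⟨w, hw, hwf⟩ := hn.1 _ (hle n s hsn)
    refine ⟨?_, ?_, fun a ha => hn.1 a (ha.trans (hle n s hsn))⟩ <;> simp [hv, hwf, hw]
  have hlim : ∀ s : ℝ, ∃ l, Tendsto (fun n => v n s) U (𝓝 l) := by
    intro s
    obtain ⟨l, -, hl⟩ := hN.isCompact_closure.ultrafilter_le_nhds (U.map fun n => v n s) (by
      rw [le_principal_iff]
      exact (hflow s).mono fun n hn => subset_closure ⟨z n, _, hn.2.2, hn.2.1⟩)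
    exact ⟨l, hl⟩
  choose u hu using hlim
  have huN : ∀ s, u s ∈ N := fun s =>
    hNc.mem_of_tendsto (hu s) ((hflow s).mono fun n hn => hn.1)
  have hval : ∀ (s : ℝ) (t : ℝ≥0) (q : Z), π.flow t (u s) = some q → q = u (s + t) := by
    intro s t q hq
    refine tendsto_nhds_unique (f := fun n => v n (s + t)) (l := (U : Filter ℕ)) ?_ (hu _)
    rw [tendsto_nhds]
    intro V hV hqV
    have hmem : ∀ᶠ y in 𝓝 (u s), π.mem t y V :=
      ((isOpen_setOf_mem hV).preimage (f := fun y : Z => (t, y)) (by fun_prop)).mem_nhds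
        ⟨q, hqV, hq⟩
    filter_upwards [(hu s).eventually hmem, hflow s, hflow (s + t), hlarge |s|]
      with n ⟨w, hw, hwf⟩ hns hnst hsn
    have hadd : Real.toNNReal (n + (s + t)) = Real.toNNReal (n + s) + t := by
      rw [← add_assoc, Real.toNNReal_add (by linarith [neg_abs_le s]) t.coe_nonneg,
        Real.toNNReal_coe]
    have := hnst.2.1
    rw [hadd, flow_add_of_flow_eq hns.2.1, hwf] at this
    rw [mem_preimage, ← Option.some_injective _ this]
    exact hw
  have husol : π.IsSolution u := by
    intro s t
    obtain ⟨q, hq⟩ := Option.isSome_iff_exists.mp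
      (NonExploding.isSome_flow hN.2 (p := u s) (t := t)
        fun a _ q hq => hval s a q hq ▸ huN _)
    rw [hq, hval s t q hq]
  have hWn : W ∈ 𝓝[E] (u 0) := hW _ ⟨u, husol, huN, rfl⟩
  have hin : Tendsto (fun n => v n 0) U (𝓝[E] (u 0)) :=
    tendsto_nhdsWithin_iff.mpr ⟨hu 0, (hflow 0).mono fun n hn => hNE hn.1⟩
  obtain ⟨n, hn, hnW, hnf⟩ := (hz.and ((hin.eventually hWn).and (hflow 0))).exists
  refine hn.2 ⟨v n 0, hnW, ?_⟩
  simpa using hnf.2.1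

end Admissible

end PartialSemiflow

namespace PtdQuot

variable {Z : Type*} [TopologicalSpace Z] {A B : Set Z}

/-- The class of `a : A` in `A/B`. -/
def mk (A B : Set Z) (a : A) : PtdQuot A B := Quot.mk _ (Sum.inl a)

open Classical in
/-- The class of `z` in `A/B`, with all points outside `A` sent to the base point. -/
def proj (A B : Set Z) (z : Z) : PtdQuot A B :=
  if h : z ∈ A then mk A B ⟨z, h⟩ else pt A B

theorem proj_coe (a : A) : proj A B a = mk A B a := by
  simp [proj]

theorem proj_eq_pt {z : Z} (hz : z ∈ B) : proj A B z = pt A B := by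
  by_cases h : z ∈ A
  · rw [proj, dif_pos h]
    exact Quot.sound (show quotRel A B (Sum.inl ⟨z, h⟩) (Sum.inr ()) from hz)
  · simp [proj, h]

theorem continuous_proj_coe : Continuous fun a : A => proj A B a := by
  simp only [proj_coe]
  exact continuous_quot_mk.comp continuous_inl

end PtdQuot

namespace PartialSemiflow

section Transfer

variable {Z : Type*} [TopologicalSpace Z] {χ : PartialSemiflow Z}

/-- A pair `(N₁, N₂)` of closed sets satisfying the exit and positive invariance properties of
an index pair, such that `N₁ \ N₂` is contained in a closed set `D` in which `χ` does not
explode. -/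
structure IsExitPair (χ : PartialSemiflow Z) (N₁ N₂ D : Set Z) : Prop where
  closed₁ : IsClosed N₁
  closed₂ : IsClosed N₂
  closed_D : IsClosed D
  diff_subset : N₁ \ N₂ ⊆ D
  nonExploding : χ.NonExploding D
  exit : ∀ p ∈ N₁, ∀ t : ℝ≥0, (∀ s ≤ t, ¬ χ.mem s p N₂) → χ.mem t p N₁
  posInv : ∀ p ∈ N₂, ∀ t : ℝ≥0, (∀ s ≤ t, χ.mem s p N₁) → χ.mem t p N₂

/-- The midpoint of every orbit segment of length `2 * t` in `A` lies in `B`. -/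
def MidMem (χ : PartialSemiflow Z) (A B : Set Z) (t : ℝ≥0) : Prop :=
  ∀ p, χ.segMem (2 * t) p A → χ.mem t p B

/-- The orbit of `p` stays in `A` on `[0, 2 * t]` and in `B` on `[t, 3 * t]`. -/
def PassesThrough (χ : PartialSemiflow Z) (A B : Set Z) (t : ℝ≥0) (p : Z) : Prop :=
  (∀ s ∈ Icc 0 (2 * t), χ.mem s p A) ∧ ∀ s ∈ Icc t (3 * t), χ.mem s p B

open Classical in
/-- The map sending `p` to the class of `p χ (3 * t)` in `M₁/M₂` if the orbit of `p` passes
through `A` and `B`, and to the base point otherwise. -/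
def transfer (χ : PartialSemiflow Z) (A M₁ M₂ : Set Z) (t : ℝ≥0) (p : Z) : PtdQuot M₁ M₂ :=
  if χ.PassesThrough A (M₁ \ M₂) t p then
    (χ.flow (3 * t) p).elim (PtdQuot.pt M₁ M₂) (PtdQuot.proj M₁ M₂)
  else PtdQuot.pt M₁ M₂

theorem transfer_of_passesThrough {A M₁ M₂ : Set Z} {t : ℝ≥0} {p q : Z}
    (h : χ.PassesThrough A (M₁ \ M₂) t p) (hq : χ.flow (3 * t) p = some q) :
    χ.transfer A M₁ M₂ t p = PtdQuot.proj M₁ M₂ q := by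
  simp [transfer, h, hq]

theorem transfer_of_not_passesThrough {A M₁ M₂ : Set Z} {t : ℝ≥0} {p : Z}
    (h : ¬ χ.PassesThrough A (M₁ \ M₂) t p) :
    χ.transfer A M₁ M₂ t p = PtdQuot.pt M₁ M₂ := by
  simp [transfer, h]

theorem transfer_of_notMem {A M₁ M₂ : Set Z} {t : ℝ≥0} {p : Z} (h : p ∉ A) :
    χ.transfer A M₁ M₂ t p = PtdQuot.pt M₁ M₂ :=
  transfer_of_not_passesThrough fun hp => h (mem_zero_iff.mp (hp.1 0 ⟨le_rfl, zero_le⟩))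

theorem transfer_mem_iff {A M₁ M₂ : Set Z} {t : ℝ≥0} {p : Z} {V : Set (PtdQuot M₁ M₂)}
    (hV : PtdQuot.pt M₁ M₂ ∉ V) :
    χ.transfer A M₁ M₂ t p ∈ V ↔ χ.PassesThrough A (M₁ \ M₂) t p ∧
      χ.mem (3 * t) p {z ∈ M₁ | PtdQuot.proj M₁ M₂ z ∈ V} := by
  by_cases h : χ.PassesThrough A (M₁ \ M₂) t p
  · obtain ⟨q, hq, hqf⟩ := h.2 (3 * t) ⟨le_mul_of_one_le_left' (by norm_num), le_rfl⟩
    rw [transfer_of_passesThrough h hqf, mem_iff_of_flow_eq hqf]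
    exact ⟨fun hV => ⟨h, hq.1, hV⟩, fun hV => hV.2.2⟩
  · simp [transfer_of_not_passesThrough h, h, hV]

theorem forall_mem_Icc_mul_iff {c d t : ℝ≥0} (hcd : c ≤ d) {P : ℝ≥0 → Prop} :
    (∀ s ∈ Icc (c * t) (d * t), P s) ↔ ∀ a ∈ Icc c d, P (a * t) := by
  refine ⟨fun h a ha => h _ ⟨by gcongr; exact ha.1, by gcongr; exact ha.2⟩, fun h s hs => ?_⟩
  rcases eq_or_ne t 0 with rfl | ht
  · obtain rfl : s = 0 := by simpa using hs.2
    simpa using h c ⟨le_rfl, hcd⟩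
  · have ht' : 0 < t := pos_iff_ne_zero.mpr ht
    have := h (s / t) ⟨(le_div_iff₀ ht').mpr hs.1, (div_le_iff₀ ht').mpr hs.2⟩
    rwa [div_mul_cancel₀ _ ht] at this

theorem isOpen_forall_Icc_mem {U : Set Z} (hU : IsOpen U) {c d : ℝ≥0} (hcd : c ≤ d) :
    IsOpen {x : ℝ≥0 × Z | ∀ s ∈ Icc (c * x.1) (d * x.1), χ.mem s x.2 U} := by
  simp only [forall_mem_Icc_mul_iff hcd]
  rw [isOpen_iff_mem_nhds]
  intro x hx
  refine isCompact_Icc.eventually_forall_of_forall_eventually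
    (P := fun (x : ℝ≥0 × Z) (a : ℝ≥0) => χ.mem (a * x.1) x.2 U) fun a ha => ?_
  exact ((isOpen_setOf_mem hU).preimage
    (f := fun y : (ℝ≥0 × Z) × ℝ≥0 => (y.2 * y.1.1, y.1.2)) (by fun_prop)).mem_nhds (hx a ha)

/-- For points of `N₁`, passing through both exit pairs amounts to avoiding the exit sets. -/
theorem IsExitPair.passesThrough_iff {N₁ N₂ D M₁ M₂ D' : Set Z} (hN : χ.IsExitPair N₁ N₂ D)
    (hM : χ.IsExitPair M₁ M₂ D') {t : ℝ≥0} (hNM : χ.MidMem (N₁ \ N₂) (M₁ \ M₂) t) {p : Z}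
    (hp : p ∈ N₁) :
    χ.PassesThrough (N₁ \ N₂) (M₁ \ M₂) t p ↔
      (∀ s ∈ Icc (0 * t) (2 * t), χ.mem s p N₂ᶜ) ∧
        ∀ s ∈ Icc (1 * t) (3 * t), χ.mem s p M₂ᶜ := by
  rw [zero_mul, one_mul]
  refine ⟨fun h => ⟨fun s hs => (h.1 s hs).mono fun _ hz => hz.2,
    fun s hs => (h.2 s hs).mono fun _ hz => hz.2⟩, fun ⟨h₁, h₂⟩ => ?_⟩
  have hnot : ∀ {s p} {B : Set Z}, χ.mem s p Bᶜ → ¬ χ.mem s p B := by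
    rintro s p B ⟨w, hw, hwf⟩ h
    exact hw ((mem_iff_of_flow_eq hwf).mp h)
  have hA : ∀ s ∈ Icc 0 (2 * t), χ.mem s p (N₁ \ N₂) := fun s hs =>
    (hN.exit p hp s fun a ha => hnot (h₁ a ⟨zero_le, ha.trans hs.2⟩)).diff (hnot (h₁ s hs))
  refine ⟨hA, fun s hs => ?_⟩
  obtain ⟨q, hq, hqf⟩ := hNM p fun s hs => hA s ⟨zero_le, hs⟩
  obtain ⟨b, rfl⟩ := exists_add_of_le hs.1
  refine mem.diff ?_ (hnot (h₂ _ hs))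
  rw [mem_add_iff_of_flow_eq hqf]
  refine hM.exit q hq.1 b fun a ha => ?_
  rw [← mem_add_iff_of_flow_eq hqf]
  exact hnot (h₂ _ ⟨le_self_add, (add_le_add_right ha t).trans hs.2⟩)

theorem mem_of_mem_closure {S : Set (ℝ≥0 × Z)} {x : ℝ≥0 × Z} (hx : x ∈ closure S) {B : Set Z}
    (hB : IsClosed B) {a : ℝ≥0} (hS : ∀ y ∈ S, χ.mem (a * y.1) y.2 B) {q : Z}
    (hq : χ.flow (a * x.1) x.2 = some q) : q ∈ B := by
  by_contra hqB
  have hopen : IsOpen {y : ℝ≥0 × Z | χ.mem (a * y.1) y.2 Bᶜ} :=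
    (isOpen_setOf_mem hB.isOpen_compl).preimage
      (f := fun y : ℝ≥0 × Z => (a * y.1, y.2)) (by fun_prop)
  obtain ⟨y, hyB, hyS⟩ := mem_closure_iff.mp hx _ hopen ⟨q, hqB, hq⟩
  obtain ⟨w, hw, hwf⟩ := hyB
  exact hw ((mem_iff_of_flow_eq hwf).mp (hS y hyS))

theorem IsExitPair.passesThrough_of_mem_closure {N₁ N₂ D M₁ M₂ D' : Set Z}
    (hN : χ.IsExitPair N₁ N₂ D) (hM : χ.IsExitPair M₁ M₂ D') {C : Set Z} (hC : IsClosed C)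
    (hCM : Disjoint C M₂) {x : ℝ≥0 × Z} (hMN : χ.MidMem (M₁ \ M₂) (N₁ \ N₂) x.1)
    (hx : x ∈ closure {y : ℝ≥0 × Z |
      χ.PassesThrough (N₁ \ N₂) (M₁ \ M₂) y.1 y.2 ∧ χ.mem (3 * y.1) y.2 C}) :
    χ.PassesThrough (N₁ \ N₂) (M₁ \ M₂) x.1 x.2 ∧ χ.mem (3 * x.1) x.2 C := by
  have hlim₁ : ∀ {B : Set Z}, IsClosed B → N₁ \ N₂ ⊆ B → ∀ s ∈ Icc (0 * x.1) (2 * x.1),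
      ∀ q, χ.flow s x.2 = some q → q ∈ B := by
    intro B hB hsub
    rw [forall_mem_Icc_mul_iff zero_le]
    intro a ha q hq
    refine mem_of_mem_closure hx hB (fun y hy => (hy.1.1 _ ⟨zero_le, ?_⟩).mono hsub) hq
    gcongr
    exact ha.2
  have hlim₂ : ∀ {B : Set Z}, IsClosed B → M₁ \ M₂ ⊆ B → ∀ s ∈ Icc (1 * x.1) (3 * x.1),
      ∀ q, χ.flow s x.2 = some q → q ∈ B := by
    intro B hB hsub
    rw [forall_mem_Icc_mul_iff (by norm_num)]
    intro a ha q hq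
    refine mem_of_mem_closure hx hB (fun y hy => (hy.1.2 _ ⟨?_, ?_⟩).mono hsub) hq
    · exact le_mul_of_one_le_left' ha.1
    · gcongr
      exact ha.2
  rw [zero_mul] at hlim₁
  rw [one_mul] at hlim₂
  obtain ⟨t, p⟩ := x
  dsimp only at *
  have h12 : t ≤ 2 * t := le_mul_of_one_le_left' (by norm_num)
  have h13 : t ≤ 3 * t := le_mul_of_one_le_left' (by norm_num)
  have h23 : 3 * t = t + 2 * t := by ring
  have hdef₁ : ∀ s ≤ 2 * t, ∃ q, χ.flow s p = some q := fun s hs =>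
    Option.isSome_iff_exists.mp <| hN.nonExploding.isSome_flow fun a ha q hq =>
      hlim₁ hN.closed_D hN.diff_subset a ⟨zero_le, ha.trans hs⟩ q hq
  obtain ⟨q, hq⟩ := hdef₁ t h12
  have hdef₂ : ∀ s ∈ Icc t (3 * t), ∃ q, χ.flow s p = some q := by
    intro s hs
    obtain ⟨b, rfl⟩ := exists_add_of_le hs.1
    rw [flow_add_of_flow_eq hq]
    refine Option.isSome_iff_exists.mp <| hM.nonExploding.isSome_flow fun a ha q' hq' =>
      hlim₂ hM.closed_D hM.diff_subset (t + a) ⟨le_self_add, (add_le_add_right ha t).trans hs.2⟩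
        q' ?_
    rwa [flow_add_of_flow_eq hq]
  have hN₁ : ∀ s ≤ 2 * t, χ.mem s p N₁ := fun s hs =>
    let ⟨w, hw⟩ := hdef₁ s hs
    ⟨w, hlim₁ hN.closed₁ Set.sdiff_subset s ⟨zero_le, hs⟩ w hw, hw⟩
  have hM₁ : ∀ s ∈ Icc t (3 * t), χ.mem s p M₁ := fun s hs =>
    let ⟨w, hw⟩ := hdef₂ s hs
    ⟨w, hlim₂ hM.closed₁ Set.sdiff_subset s hs w hw, hw⟩
  have hCx : χ.mem (3 * t) p C :=
    let ⟨w, hw⟩ := hdef₂ (3 * t) ⟨h13, le_rfl⟩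
    ⟨w, mem_of_mem_closure hx hC (fun y hy => hy.2) hw, hw⟩
  have hMd : ∀ s ∈ Icc t (3 * t), χ.mem s p (M₁ \ M₂) := by
    intro s hs
    refine (hM₁ s hs).diff fun ⟨w, hw, hwf⟩ => ?_
    obtain ⟨b, hb⟩ := exists_add_of_le hs.2
    have hend : χ.mem b w M₂ := hM.posInv w hw b fun a ha => by
      rw [← mem_add_iff_of_flow_eq hwf]
      exact hM₁ _ ⟨hs.1.trans le_self_add, hb ▸ add_le_add_right ha s⟩
    rw [← mem_add_iff_of_flow_eq hwf, ← hb] at hend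
    obtain ⟨w', hw', hwf'⟩ := hCx
    exact hCM.notMem_of_mem_left hw' ((mem_iff_of_flow_eq hwf').mp hend)
  have hmid : χ.mem (2 * t) p (N₁ \ N₂) := by
    rw [two_mul, mem_add_iff_of_flow_eq hq]
    refine hMN q fun s hs => ?_
    rw [← mem_add_iff_of_flow_eq hq]
    exact hMd _ ⟨le_self_add, h23 ▸ add_le_add_right hs t⟩
  refine ⟨⟨fun s hs => (hN₁ s hs.2).diff fun ⟨w, hw, hwf⟩ => ?_, hMd⟩, hCx⟩
  obtain ⟨b, hb⟩ := exists_add_of_le hs.2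
  have hend : χ.mem b w N₂ := hN.posInv w hw b fun a ha => by
    rw [← mem_add_iff_of_flow_eq hwf]
    exact hN₁ _ (hb ▸ add_le_add_right ha s)
  rw [← mem_add_iff_of_flow_eq hwf, ← hb] at hend
  obtain ⟨w', hw', hwf'⟩ := hmid
  exact hw'.2 ((mem_iff_of_flow_eq hwf').mp hend)

theorem IsExitPair.continuous_transfer {N₁ N₂ D M₁ M₂ D' : Set Z} (hN : χ.IsExitPair N₁ N₂ D)
    (hM : χ.IsExitPair M₁ M₂ D') {Λ : Type*} [TopologicalSpace Λ] {τ : Λ → ℝ≥0}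
    (hτ : Continuous τ) (hNM : ∀ l, χ.MidMem (N₁ \ N₂) (M₁ \ M₂) (τ l))
    (hMN : ∀ l, χ.MidMem (M₁ \ M₂) (N₁ \ N₂) (τ l)) :
    Continuous fun x : Λ × N₁ => χ.transfer (N₁ \ N₂) M₁ M₂ (τ x.1) x.2 := by
  have hj : Continuous fun x : Λ × N₁ => (τ x.1, (x.2 : Z)) := by fun_prop
  rw [continuous_def]
  intro V hV
  by_cases hpt : PtdQuot.pt M₁ M₂ ∈ V
  · rw [← isClosed_compl_iff, ← preimage_compl]
    set C : Set Z := {z ∈ M₁ | PtdQuot.proj M₁ M₂ z ∈ Vᶜ}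
    have hpt' : PtdQuot.pt M₁ M₂ ∉ Vᶜ := not_not.mpr hpt
    have hCc : IsClosed C := by
      have := hM.closed₁.isClosedEmbedding_subtypeVal.isClosedMap _
        (hV.isClosed_compl.preimage (PtdQuot.continuous_proj_coe (A := M₁) (B := M₂)))
      convert this using 1
      ext z
      constructor
      · rintro ⟨hz₁, hz₂⟩
        exact ⟨⟨z, hz₁⟩, hz₂, rfl⟩
      · rintro ⟨a, ha, rfl⟩
        exact ⟨a.2, ha⟩
    have hCM : Disjoint C M₂ := Set.disjoint_left.mpr fun z hz hz₂ =>
      hpt' (PtdQuot.proj_eq_pt hz₂ ▸ hz.2)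
    have heq : (fun x : Λ × N₁ => χ.transfer (N₁ \ N₂) M₁ M₂ (τ x.1) x.2) ⁻¹' Vᶜ =
        (fun x : Λ × N₁ => (τ x.1, (x.2 : Z))) ⁻¹' {y : ℝ≥0 × Z |
          χ.PassesThrough (N₁ \ N₂) (M₁ \ M₂) y.1 y.2 ∧ χ.mem (3 * y.1) y.2 C} := by
      ext x
      exact transfer_mem_iff hpt'
    rw [heq]
    refine isClosed_of_closure_subset fun x hx => ?_
    exact hN.passesThrough_of_mem_closure hM hCc hCM (hMN x.1)
      (hj.closure_preimage_subset _ hx)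
  · obtain ⟨O, hO, hOV⟩ := isOpen_induced_iff.mp
      (hV.preimage (PtdQuot.continuous_proj_coe (A := M₁) (B := M₂)))
    have hOV' : ∀ z ∈ M₁, (z ∈ O ↔ PtdQuot.proj M₁ M₂ z ∈ V) := fun z hz =>
      Set.ext_iff.mp hOV ⟨z, hz⟩
    have heq : (fun x : Λ × N₁ => χ.transfer (N₁ \ N₂) M₁ M₂ (τ x.1) x.2) ⁻¹' V =
        (fun x : Λ × N₁ => (τ x.1, (x.2 : Z))) ⁻¹'
          (({y : ℝ≥0 × Z | ∀ s ∈ Icc (0 * y.1) (2 * y.1), χ.mem s y.2 N₂ᶜ} ∩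
            {y : ℝ≥0 × Z | ∀ s ∈ Icc (1 * y.1) (3 * y.1), χ.mem s y.2 M₂ᶜ}) ∩
            {y : ℝ≥0 × Z | χ.mem (3 * y.1) y.2 O}) := by
      ext x
      rw [mem_preimage, transfer_mem_iff hpt, mem_preimage, mem_inter_iff]
      have hiff := hN.passesThrough_iff hM (hNM x.1) x.2.2
      refine Iff.trans (and_congr_right fun hpass => ?_) (and_congr_left' hiff)
      obtain ⟨q, hq, hqf⟩ := hpass.2 (3 * τ x.1) ⟨le_mul_of_one_le_left' (by norm_num), le_rfl⟩
      change χ.mem _ _ _ ↔ χ.mem _ _ _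
      rw [mem_iff_of_flow_eq hqf, mem_iff_of_flow_eq hqf, hOV' q hq.1]
      exact ⟨fun h => h.2, fun h => ⟨hq.1, h⟩⟩
    rw [heq]
    refine IsOpen.preimage hj (((isOpen_forall_Icc_mem hN.closed₂.isOpen_compl zero_le).inter
      (isOpen_forall_Icc_mem hM.closed₂.isOpen_compl (by norm_num))).inter ?_)
    exact (isOpen_setOf_mem hO).preimage
      (f := fun y : ℝ≥0 × Z => (3 * y.1, y.2)) (by fun_prop)

/-- The map induced by `transfer` on the quotient `N₁/N₂`. -/
def quotTransfer (χ : PartialSemiflow Z) (N₁ N₂ M₁ M₂ : Set Z) (t : ℝ≥0) :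
    PtdQuot N₁ N₂ → PtdQuot M₁ M₂ :=
  Quot.lift (Sum.elim (fun a : N₁ => χ.transfer (N₁ \ N₂) M₁ M₂ t a)
    fun _ => PtdQuot.pt M₁ M₂) (by
      have hpt : ∀ {z : Z}, z ∈ N₂ → χ.transfer (N₁ \ N₂) M₁ M₂ t z = PtdQuot.pt M₁ M₂ :=
        fun hz => transfer_of_notMem fun h => h.2 hz
      rintro (a | a) (b | b) h
      · rcases h with rfl | ⟨ha, hb⟩
        · rfl
        · exact (hpt ha).trans (hpt hb).symm
      · exact hpt h
      · exact (hpt h).symm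
      · rfl)

@[simp]
theorem quotTransfer_pt {N₁ N₂ M₁ M₂ : Set Z} {t : ℝ≥0} :
    χ.quotTransfer N₁ N₂ M₁ M₂ t (PtdQuot.pt N₁ N₂) = PtdQuot.pt M₁ M₂ := rfl

theorem quotTransfer_proj {N₁ N₂ M₁ M₂ : Set Z} {t : ℝ≥0} {p : Z} (hp : p ∈ N₁) :
    χ.quotTransfer N₁ N₂ M₁ M₂ t (PtdQuot.proj N₁ N₂ p) =
      χ.transfer (N₁ \ N₂) M₁ M₂ t p := by
  rw [PtdQuot.proj, dif_pos hp]; rfl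

theorem IsExitPair.continuous_quotTransfer {N₁ N₂ D M₁ M₂ D' : Set Z}
    (hN : χ.IsExitPair N₁ N₂ D) (hM : χ.IsExitPair M₁ M₂ D') {Λ : Type*} [TopologicalSpace Λ]
    [LocallyCompactSpace Λ] {τ : Λ → ℝ≥0} (hτ : Continuous τ)
    (hNM : ∀ l, χ.MidMem (N₁ \ N₂) (M₁ \ M₂) (τ l))
    (hMN : ∀ l, χ.MidMem (M₁ \ M₂) (N₁ \ N₂) (τ l)) :
    Continuous fun x : Λ × PtdQuot N₁ N₂ => χ.quotTransfer N₁ N₂ M₁ M₂ (τ x.1) x.2 := by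
  have hquot : IsQuotientMap (Quot.mk (quotRel N₁ N₂)) := isQuotientMap_quot_mk
  refine hquot.continuous_lift_prod_right
    (g := fun x : Λ × PtdQuot N₁ N₂ => χ.quotTransfer N₁ N₂ M₁ M₂ (τ x.1) x.2) ?_
  rw [← (Homeomorph.prodSumDistrib (X := Λ) (Y := N₁) (Z := Unit)).symm.comp_continuous_iff']
  rw [continuous_sum_dom]
  exact ⟨hN.continuous_transfer hM hτ hNM hMN, continuous_const⟩

theorem midMem_self (A : Set Z) (t : ℝ≥0) : χ.MidMem A A t :=
  fun _ hp => hp t (le_mul_of_one_le_left' (by norm_num))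

theorem passesThrough_self_iff {A : Set Z} {t : ℝ≥0} {p : Z} :
    χ.PassesThrough A A t p ↔ χ.segMem (3 * t) p A := by
  refine ⟨fun h s hs => ?_, fun h => ⟨fun s hs => h s (hs.2.trans ?_), fun s hs => h s hs.2⟩⟩
  · rcases le_total s t with hst | hst
    · exact h.1 s ⟨zero_le, hst.trans (le_mul_of_one_le_left' (by norm_num))⟩
    · exact h.2 s ⟨hst, hs⟩
  · gcongr
    norm_num

theorem quotTransfer_self_zero {N₁ N₂ : Set Z} (x : PtdQuot N₁ N₂) :
    χ.quotTransfer N₁ N₂ N₁ N₂ 0 x = x := by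
  induction x using Quot.ind with | _ x => ?_
  rcases x with ⟨p, hp⟩ | _
  · change χ.transfer _ _ _ _ p = _
    by_cases hp₂ : p ∈ N₂
    · rw [transfer_of_notMem fun h => h.2 hp₂, ← PtdQuot.proj_eq_pt hp₂]
      exact PtdQuot.proj_coe (A := N₁) ⟨p, hp⟩
    · rw [transfer_of_passesThrough (q := p)]
      · exact PtdQuot.proj_coe (A := N₁) ⟨p, hp⟩
      · rw [passesThrough_self_iff]
        intro s hs
        obtain rfl : s = 0 := by simpa using hs
        exact mem_zero_iff.mpr ⟨hp, hp₂⟩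
      · rw [mul_zero, χ.flow_zero]
  · rfl

theorem quotTransfer_comp {N₁ N₂ M₁ M₂ : Set Z} {t : ℝ≥0}
    (hNM : χ.MidMem (N₁ \ N₂) (M₁ \ M₂) t) (hMN : χ.MidMem (M₁ \ M₂) (N₁ \ N₂) t)
    (x : PtdQuot N₁ N₂) :
    χ.quotTransfer M₁ M₂ N₁ N₂ t (χ.quotTransfer N₁ N₂ M₁ M₂ t x) =
      χ.quotTransfer N₁ N₂ N₁ N₂ (2 * t) x := by
  have hshift : ∀ {A B : Set Z}, χ.MidMem A B t → ∀ {p : Z} {s : ℝ≥0},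
      (∀ r ∈ Icc s (s + 2 * t), χ.mem r p A) → χ.mem (s + t) p B := by
    intro A B hAB p s h
    obtain ⟨q, -, hqf⟩ := h s ⟨le_rfl, le_self_add⟩
    rw [mem_add_iff_of_flow_eq hqf]
    refine hAB q fun r hr => ?_
    rw [← mem_add_iff_of_flow_eq hqf]
    exact h _ ⟨le_self_add, add_le_add_right hr s⟩
  induction x using Quot.ind with | _ x => ?_
  rcases x with ⟨p, hp⟩ | _
  swap
  · rfl
  change χ.quotTransfer M₁ M₂ N₁ N₂ t (χ.transfer (N₁ \ N₂) M₁ M₂ t p) =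
    χ.transfer (N₁ \ N₂) N₁ N₂ (2 * t) p
  have hM_of_N : χ.segMem (3 * (2 * t)) p (N₁ \ N₂) →
      ∀ s ∈ Icc t (5 * t), χ.mem s p (M₁ \ M₂) := by
    intro h s hs
    obtain ⟨b, rfl⟩ := exists_add_of_le hs.1
    rw [add_comm]
    refine hshift hNM fun r hr => h r (hr.2.trans ?_)
    calc b + 2 * t = (t + b) + t := by ring
      _ ≤ 5 * t + t := by gcongr; exact hs.2
      _ = 3 * (2 * t) := by ring
  by_cases hpass : χ.PassesThrough (N₁ \ N₂) (M₁ \ M₂) t p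
  · obtain ⟨q, hq, hqf⟩ := hpass.2 (3 * t) ⟨le_mul_of_one_le_left' (by norm_num), le_rfl⟩
    rw [transfer_of_passesThrough hpass hqf, quotTransfer_proj hq.1]
    have hiff : χ.PassesThrough (M₁ \ M₂) (N₁ \ N₂) t q ↔
        χ.PassesThrough (N₁ \ N₂) (N₁ \ N₂) (2 * t) p := by
      rw [passesThrough_self_iff]
      constructor
      · intro h s hs
        have hM : ∀ r ∈ Icc t (5 * t), χ.mem r p (M₁ \ M₂) := by
          intro r hr
          rcases le_total r (3 * t) with hr3 | hr3
          · exact hpass.2 r ⟨hr.1, hr3⟩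
          · obtain ⟨b, rfl⟩ := exists_add_of_le hr3
            rw [mem_add_iff_of_flow_eq hqf]
            refine h.1 b ⟨zero_le, (add_le_add_iff_left (3 * t)).mp (hr.2.trans_eq (by ring))⟩
        rcases le_total s (2 * t) with hs2 | hs2
        · exact hpass.1 s ⟨zero_le, hs2⟩
        rcases le_total s (4 * t) with hs4 | hs4
        · obtain ⟨b, rfl⟩ := exists_add_of_le hs2
          have : 2 * t + b = (t + b) + t := by ring
          rw [this]
          refine hshift hMN fun r hr => hM r ⟨le_self_add.trans hr.1, hr.2.trans ?_⟩
          calc t + b + 2 * t = (2 * t + b) + t := by ring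
            _ ≤ 4 * t + t := by gcongr
            _ = 5 * t := by ring
        · obtain ⟨b, rfl⟩ := exists_add_of_le hs4
          have : 4 * t + b = 3 * t + (t + b) := by ring
          rw [this, mem_add_iff_of_flow_eq hqf]
          refine h.2 _ ⟨le_self_add, (add_le_add_iff_left (3 * t)).mp ?_⟩
          calc 3 * t + (t + b) = 4 * t + b := by ring
            _ ≤ 3 * (2 * t) := hs
            _ = 3 * t + 3 * t := by ring
      · intro h
        refine ⟨fun s hs => ?_, fun s hs => ?_⟩ <;> rw [← mem_add_iff_of_flow_eq hqf]
        · refine hM_of_N h _ ⟨(le_mul_of_one_le_left' (by norm_num)).trans le_self_add, ?_⟩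
          calc 3 * t + s ≤ 3 * t + 2 * t := by gcongr; exact hs.2
            _ = 5 * t := by ring
        · refine h _ ?_
          calc 3 * t + s ≤ 3 * t + 3 * t := by gcongr; exact hs.2
            _ = 3 * (2 * t) := by ring
    by_cases hpass' : χ.PassesThrough (M₁ \ M₂) (N₁ \ N₂) t q
    · obtain ⟨q', -, hqf'⟩ :=
        hpass'.2 (3 * t) ⟨le_mul_of_one_le_left' (by norm_num), le_rfl⟩
      rw [transfer_of_passesThrough hpass' hqf',
        transfer_of_passesThrough (hiff.mp hpass') (q := q')]
      rw [← hqf', ← flow_add_of_flow_eq hqf]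
      congr 1
      ring
    · rw [transfer_of_not_passesThrough hpass',
        transfer_of_not_passesThrough (mt hiff.mpr hpass')]
  · rw [transfer_of_not_passesThrough hpass, quotTransfer_pt,
      transfer_of_not_passesThrough]
    rw [passesThrough_self_iff]
    refine fun h => hpass ⟨fun s hs => h s (hs.2.trans ?_), fun s hs =>
      hM_of_N h s ⟨hs.1, hs.2.trans ?_⟩⟩
    · calc 2 * t ≤ 6 * t := by gcongr; norm_num
        _ = 3 * (2 * t) := by ring
    · gcongr
      norm_num

theorem IsExitPair.homotopyRel_comp {N₁ N₂ D M₁ M₂ : Set Z} (hN : χ.IsExitPair N₁ N₂ D)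
    {t : ℝ≥0} (hNM : χ.MidMem (N₁ \ N₂) (M₁ \ M₂) t) (hMN : χ.MidMem (M₁ \ M₂) (N₁ \ N₂) t)
    {f : C(PtdQuot N₁ N₂, PtdQuot M₁ M₂)} {g : C(PtdQuot M₁ M₂, PtdQuot N₁ N₂)}
    (hf : ⇑f = χ.quotTransfer N₁ N₂ M₁ M₂ t) (hg : ⇑g = χ.quotTransfer M₁ M₂ N₁ N₂ t) :
    Nonempty (ContinuousMap.HomotopyRel (g.comp f) (ContinuousMap.id _) {PtdQuot.pt N₁ N₂}) := by
  have hcomp : ∀ x, (g.comp f) x = χ.quotTransfer N₁ N₂ N₁ N₂ (2 * t) x := fun x => by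
    rw [ContinuousMap.comp_apply, hf, hg, quotTransfer_comp hNM hMN]
  refine ⟨⟨⟨⟨fun x => χ.quotTransfer N₁ N₂ N₁ N₂ (2 * t * unitInterval.toNNReal
    (unitInterval.symm x.1)) x.2, ?_⟩, fun x => ?_, fun x => ?_⟩, ?_⟩⟩
  · exact hN.continuous_quotTransfer hN
      (τ := fun s => 2 * t * unitInterval.toNNReal (unitInterval.symm s)) (by fun_prop) (fun _ => midMem_self _ _)
      fun _ => midMem_self _ _
  · simp [hcomp]
  · simp [quotTransfer_self_zero]
  · rintro s x rfl
    change PtdQuot.pt N₁ N₂ = _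
    rw [hcomp, quotTransfer_pt]

theorem IsExitPair.pointedHomotopyEquivalent {N₁ N₂ D M₁ M₂ D' : Set Z}
    (hN : χ.IsExitPair N₁ N₂ D) (hM : χ.IsExitPair M₁ M₂ D') {t : ℝ≥0}
    (hNM : χ.MidMem (N₁ \ N₂) (M₁ \ M₂) t) (hMN : χ.MidMem (M₁ \ M₂) (N₁ \ N₂) t) :
    PointedHomotopyEquivalent (PtdQuot.pt N₁ N₂) (PtdQuot.pt M₁ M₂) := by
  have hcont : ∀ {N₁ N₂ D M₁ M₂ D' : Set Z}, χ.IsExitPair N₁ N₂ D → χ.IsExitPair M₁ M₂ D' →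
      χ.MidMem (N₁ \ N₂) (M₁ \ M₂) t → χ.MidMem (M₁ \ M₂) (N₁ \ N₂) t →
      Continuous (χ.quotTransfer N₁ N₂ M₁ M₂ t) := fun hN hM h h' =>
    (hN.continuous_quotTransfer hM (Λ := Unit) (τ := fun _ => t) continuous_const
      (fun _ => h) fun _ => h').comp (Continuous.prodMk_right ())
  exact ⟨⟨_, hcont hN hM hNM hMN⟩, rfl, ⟨_, hcont hM hN hMN hNM⟩, rfl,
    hN.homotopyRel_comp hNM hMN rfl rfl, hM.homotopyRel_comp hMN hNM rfl rfl⟩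

end Transfer

end PartialSemiflow

section Skew

variable {X Y : Type*} [MetricSpace X] [MetricSpace Y]

theorem continuous_rMap (σ : GlobalSemiflow Y) (y₀ : Y) :
    Continuous (rMap (X := X) σ y₀) :=
  (σ.continuous_trans.comp (continuous_fst.prodMk continuous_const)).prodMk continuous_snd

/-- The semiflow `χ_{y₀}` on `[0,∞) × X`. -/
def chiSemiflow (σ : GlobalSemiflow Y) (π : PartialSemiflow (Y × X)) (hσπ : σ.IsSkewProduct π)
    (y₀ : Y) : PartialSemiflow (ℝ≥0 × X) where
  flow := chi σ π y₀
  isOpen_dom := by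
    have hc : Continuous fun p : ℝ≥0 × (ℝ≥0 × X) => (p.1, rMap σ y₀ p.2) :=
      continuous_fst.prodMk ((continuous_rMap σ y₀).comp continuous_snd)
    convert π.isOpen_dom.preimage hc using 1
    ext p
    simp [chi, rMap]
  continuous_flow V hV := by
    have hc : Continuous fun p : ℝ≥0 × (ℝ≥0 × X) => (p.1, rMap σ y₀ p.2) :=
      continuous_fst.prodMk ((continuous_rMap σ y₀).comp continuous_snd)
    rw [isOpen_iff_mem_nhds]
    rintro ⟨s, p⟩ ⟨q, hqV, hq⟩
    obtain ⟨w, hw, rfl⟩ := Option.map_eq_some_iff.mp hq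
    obtain ⟨V₁, V₂, hV₁, hV₂, hm₁, hm₂, hsub⟩ := isOpen_prod_iff.mp hV _ _ hqV
    have h₁ : IsOpen {x : ℝ≥0 × (ℝ≥0 × X) | x.2.1 + x.1 ∈ V₁} :=
      hV₁.preimage (by fun_prop)
    have h₂ := (π.continuous_flow (univ ×ˢ V₂) (isOpen_univ.prod hV₂)).preimage hc
    filter_upwards [h₁.mem_nhds hm₁, h₂.mem_nhds ⟨w, ⟨mem_univ _, hm₂⟩, hw⟩]
      with x hx₁ ⟨w', hw', hwf'⟩
    refine ⟨(x.2.1 + x.1, w'.2), hsub ⟨hx₁, hw'.2⟩, ?_⟩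
    exact Option.map_eq_some_iff.mpr ⟨w', hwf', rfl⟩
  flow_zero p := by simp [chi, π.flow_zero]
  flow_add s t p := by
    simp only [chi, π.flow_add]
    cases h : π.flow s (σ.trans p.1 y₀, p.2) with
    | none => rfl
    | some w =>
      have hw : w = (σ.trans (p.1 + s) y₀, w.2) := by
        rw [σ.trans_add]
        exact Prod.ext (hσπ _ _ _ _ h) rfl
      simp only [Option.map_some, Option.bind_some, chi, ← hw, ← add_assoc]

variable {σ : GlobalSemiflow Y} {π : PartialSemiflow (Y × X)} (hσπ : σ.IsSkewProduct π) {y₀ : Y}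

theorem flow_rMap_of_chiSemiflow {s : ℝ≥0} {p q : ℝ≥0 × X}
    (h : (chiSemiflow σ π hσπ y₀).flow s p = some q) :
    π.flow s (rMap σ y₀ p) = some (rMap σ y₀ q) := by
  obtain ⟨w, hw, rfl⟩ := Option.map_eq_some_iff.mp h
  refine hw.trans (congrArg some (Prod.ext ?_ rfl))
  exact (hσπ _ _ _ _ hw).trans (σ.trans_add _ _ _).symm

theorem mem_chiSemiflow_preimage_iff {s : ℝ≥0} {p : ℝ≥0 × X} {M : Set (Y × X)} :
    (chiSemiflow σ π hσπ y₀).mem s p (rMap σ y₀ ⁻¹' M) ↔ π.mem s (rMap σ y₀ p) M := by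
  constructor
  · rintro ⟨q, hq, hqf⟩
    exact ⟨_, hq, flow_rMap_of_chiSemiflow hσπ hqf⟩
  · rintro ⟨w, hw, hwf⟩
    have hf : (chiSemiflow σ π hσπ y₀).flow s p = some (p.1 + s, w.2) :=
      Option.map_eq_some_iff.mpr ⟨w, hwf, rfl⟩
    have := (flow_rMap_of_chiSemiflow hσπ hf).symm.trans hwf
    exact ⟨_, (Option.some_injective _ this).symm ▸ hw, hf⟩

theorem IsIndexPair.exists_isExitPair {K : Set (Y × X)} {N₁ N₂ : Set (ℝ≥0 × X)}
    (hN : IsIndexPair σ π y₀ K N₁ N₂) :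
    ∃ D, (chiSemiflow σ π hσπ y₀).IsExitPair N₁ N₂ D := by
  obtain ⟨N, hiso, hadm, hsub⟩ := hN.ip4
  refine ⟨rMap σ y₀ ⁻¹' N, hN.toBasic.closed₁, hN.toBasic.closed₂,
    hiso.2.1.preimage (continuous_rMap σ y₀), hsub, fun p t h => ?_, fun p hp t h => ?_,
    fun p hp t h => ?_⟩
  · have := hadm.2 (rMap σ y₀ p) t fun s hs =>
      (mem_chiSemiflow_preimage_iff hσπ).mp (h s hs)
    exact (Option.isSome_map ..).trans this
  · by_contra hcon
    obtain ⟨s, hs, hs'⟩ := hN.toBasic.ip2 p hp t hcon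
    exact h s hs hs'
  · by_contra hcon
    obtain ⟨s, hs, hs'⟩ := hN.toBasic.ip3 p hp t hcon
    exact hs' (h s hs)

theorem IsIndexPair.eventually_midMem {K : Set (Y × X)} {N₁ N₂ M₁ M₂ : Set (ℝ≥0 × X)}
    (hN : IsIndexPair σ π y₀ K N₁ N₂) (hM : IsIndexPair σ π y₀ K M₁ M₂) :
    ∀ᶠ n : ℕ in atTop, (chiSemiflow σ π hσπ y₀).MidMem (N₁ \ N₂) (M₁ \ M₂) n := by
  obtain ⟨N, ⟨hNE, hNc, -, hK⟩, hadm, hsub⟩ := hN.ip4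
  obtain ⟨W, ⟨-, hW⟩, hWsub⟩ := hM.ip5
  filter_upwards [hadm.eventually_mem_of_segMem hNc hNE (hK ▸ hW)] with n hn p hp
  exact ((mem_chiSemiflow_preimage_iff hσπ).mpr <| hn _ fun s hs =>
    (mem_chiSemiflow_preimage_iff hσπ).mp ((hp s hs).mono hsub)).mono hWsub

end Skew

theorem statement_1 (σ : GlobalSemiflow Y) (π : PartialSemiflow (Y × X)) (hσπ : σ.IsSkewProduct π) (y₀ : Y)
    (K : Set (Y × X)) (hKsub : K ⊆ extSpace σ y₀) (hKinv : K = π.Inv K)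
    (N₁ N₂ M₁ M₂ : Set (ℝ≥0 × X))
    (hN : IsIndexPair σ π y₀ K N₁ N₂) (hM : IsIndexPair σ π y₀ K M₁ M₂) :
    PointedHomotopyEquivalent (PtdQuot.pt N₁ N₂) (PtdQuot.pt M₁ M₂) := by
  obtain ⟨D, hND⟩ := hN.exists_isExitPair hσπ
  obtain ⟨D', hMD⟩ := hM.exists_isExitPair hσπ
  obtain ⟨n, hNM, hMN⟩ := ((hN.eventually_midMem hσπ hM).and (hM.eventually_midMem hσπ hN)).exists
  exact hND.pointedHomotopyEquivalent hMD hNM hMN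

end
end

section
/- The function g⁺ is lower semicontinuous on H⁺(y₀)×X. -/
open Filter Topology Set
open scoped NNReal ENNReal

noncomputable section

variable {X Y : Type*} [MetricSpace X] [MetricSpace Y]

variable {X Y : Type*} [MetricSpace X] [MetricSpace Y]

theorem GlobalSemiflow.trans_mem_hullPlus (σ : GlobalSemiflow Y) (y₀ : Y) (s : ℝ≥0) {y : Y}
    (hy : y ∈ hullPlus σ y₀) : σ.trans s y ∈ hullPlus σ y₀ := by
  have hcont : Continuous (σ.trans s) :=
    σ.continuous_trans.comp (Continuous.prodMk_right s)
  refine map_mem_closure hcont hy ?_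
  rintro _ ⟨t, rfl⟩
  exact ⟨t + s, σ.trans_add t s y₀⟩

theorem GlobalSemiflow.IsSkewProduct.flow_mem_extSpace {σ : GlobalSemiflow Y}
    {π : PartialSemiflow (Y × X)} (hσπ : σ.IsSkewProduct π) {y₀ : Y} {s : ℝ≥0} {z w : Y × X}
    (hz : z ∈ extSpace σ y₀) (hw : π.flow s z = some w) : w ∈ extSpace σ y₀ := by
  refine ⟨?_, mem_univ _⟩
  rw [hσπ s z.1 z.2 w hw]
  exact σ.trans_mem_hullPlus y₀ s hz.1

/-- For open `V`, the condition `z π [0,t] ⊆ V` is an open condition on `z`. -/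
theorem PartialSemiflow.eventually_segMem {Z : Type*} [TopologicalSpace Z]
    (π : PartialSemiflow Z) {V : Set Z} (hV : IsOpen V) {t : ℝ≥0} {z : Z}
    (h : π.segMem t z V) : ∀ᶠ z' in 𝓝 z, π.segMem t z' V := by
  have key : ∀ᶠ z' in 𝓝 z, ∀ s ∈ Icc (0 : ℝ≥0) t, π.mem s z' V := by
    refine isCompact_Icc.eventually_forall_of_forall_eventually fun s hs => ?_
    exact ((π.continuous_flow V hV).preimage continuous_swap).mem_nhds (h s hs.2)
  filter_upwards [key] with z' hz' s hs
  exact hz' s ⟨zero_le, hs⟩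

theorem statement_5 (σ : GlobalSemiflow Y) (π : PartialSemiflow (Y × X)) (hσπ : σ.IsSkewProduct π) (y₀ : Y)
    (K N U : Set (Y × X))
    (hNiso : IsIsolatingNbhd σ π y₀ K N) (hNadm : π.StronglyAdmissible N)
    (hUopen : ∃ V : Set (Y × X), IsOpen V ∧ U = V ∩ extSpace σ y₀)
    (hKU : K ⊆ U) (hUN : U ⊆ N) :
    LowerSemicontinuousOn (gPlus π U) (extSpace σ y₀) := by
  obtain ⟨V, hV, rfl⟩ := hUopen
  intro z _ a ha
  simp only [gPlus, lt_iSup_iff] at ha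
  obtain ⟨t, ht, hat⟩ := ha
  have hzV : π.segMem t z V := fun s hs =>
    let ⟨w, hw, hsw⟩ := ht s hs
    ⟨w, hw.1, hsw⟩
  filter_upwards [nhdsWithin_le_nhds (π.eventually_segMem hV hzV), self_mem_nhdsWithin]
    with z' hz'V hz'
  refine hat.trans_le (le_iSup₂ (f := fun (t : ℝ≥0) _ => (t : ℝ≥0∞)) t fun s hs => ?_)
  obtain ⟨w, hw, hsw⟩ := hz'V s hs
  exact ⟨w, ⟨hw, hσπ.flow_mem_extSpace hz' hsw⟩, hsw⟩

end
end
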